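/- Let k ≥ 4 and let x_k = π(u_k). Let f be a left special factor of u_k whose first letter is 0. If f is a prefix of u_k, then for every i ∈ {1,…,k}, both 0^{i−1}π(f) and 1^{i−1}π(f) are left special factors of x_k. -/

import Mathlib

open List Filter Topology

/-- The alphabet `A`: the letter `(b, j)` is the unprimed letter `j` if `b = false`
and the primed letter `j′` if `b = true`.  Only letters with `j < k` occur. -/
abbrev Letter : Type := Bool × ℕ

/-- The morphism ξ_k on letters: `0 ↦ 01`, `j ↦ j+1` for `1 ≤ j ≤ k−2`, `k−1 ↦ 0′`,
and symmetrically on primed letters with `(k−1)′ ↦ 0`. -/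
def xiL (k : ℕ) (a : Letter) : List Letter :=
  if a.2 = 0 then [(a.1, 0), (a.1, 1)]
  else if a.2 = k - 1 then [(!a.1, 0)]
  else [(a.1, a.2 + 1)]

/-- The morphism ξ_k on finite words. -/
def xiW (k : ℕ) (w : List Letter) : List Letter := w.flatMap (xiL k)

/-- The word ξ_k^n(0). -/
def xiPow (k n : ℕ) : List Letter := (xiW k)^[n] [((false : Bool), (0 : ℕ))]

/-- The projection π : A → {0,1}, with `false` playing the role of `0` and
`true` the role of `1`. -/
def proj (a : Letter) : Bool := if a.2 = 0 then a.1 else !a.1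

/-- The twin map `ℓ ↔ ℓ′` on letters. -/
def twin (a : Letter) : Letter := (!a.1, a.2)

/-- The finite word `w` occurs in the infinite word `v` at position `j`. -/
def OccursAt {α : Type*} (w : List α) (v : ℕ → α) (j : ℕ) : Prop :=
  ∀ i, i < w.length → w[i]? = some (v (j + i))

/-- The finite word `w` is a prefix of the infinite word `v`. -/
def PrefixSeq {α : Type*} (w : List α) (v : ℕ → α) : Prop := OccursAt w v 0

/-- The finite word `w` is a factor of the infinite word `v`. -/
def FactorOf {α : Type*} (w : List α) (v : ℕ → α) : Prop := ∃ j, OccursAt w v j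

/-- `v` is the fixed point `u_k = ξ_k^ω(0)`: every `ξ_k^n(0)` is a prefix of `v`. -/
def IsFixedPoint (k : ℕ) (v : ℕ → Letter) : Prop := ∀ n, PrefixSeq (xiPow k n) v

/-- `q ≥ 1` is a period of the finite word `z`. -/
def HasPeriod {α : Type*} (z : List α) (q : ℕ) : Prop :=
  1 ≤ q ∧ ∀ i, i + q < z.length → z[i]? = z[i + q]?

/-- `w` is a left special factor of the infinite word `v`. -/
def LeftSpecial {α : Type*} (w : List α) (v : ℕ → α) : Prop :=
  ∃ a b : α, a ≠ b ∧ FactorOf (a :: w) v ∧ FactorOf (b :: w) v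

/-- `w` is a right special factor of the infinite word `v`. -/
def RightSpecial {α : Type*} (w : List α) (v : ℕ → α) : Prop :=
  ∃ a b : α, a ≠ b ∧ FactorOf (w ++ [a]) v ∧ FactorOf (w ++ [b]) v

/-- `w` is a bispecial factor of the infinite word `v`. -/
def Bispecial {α : Type*} (w : List α) (v : ℕ → α) : Prop :=
  LeftSpecial w v ∧ RightSpecial w v

/-- The set of left extensions of `w` in `v`. -/
def Lext {α : Type*} (w : List α) (v : ℕ → α) : Set α := {a | FactorOf (a :: w) v}

/-- The set of right extensions of `w` in `v`. -/
def Rext {α : Type*} (w : List α) (v : ℕ → α) : Set α := {a | FactorOf (w ++ [a]) v}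

/-- `r` is a return word to `w` in `v`: it spans two consecutive occurrences of `w`. -/
def ReturnWordTo {α : Type*} (r w : List α) (v : ℕ → α) : Prop :=
  ∃ j ℓ, j < ℓ ∧ OccursAt w v j ∧ OccursAt w v ℓ ∧
    (∀ m, j < m → m < ℓ → ¬ OccursAt w v m) ∧
    r = (List.range (ℓ - j)).map (fun i => v (j + i))

/-- The factor complexity of an infinite word. -/
noncomputable def complexity {α : Type*} (v : ℕ → α) (n : ℕ) : ℕ :=
  {w : List α | w.length = n ∧ FactorOf w v}.ncard

theorem PrefixSeq.factorOf {α : Type*} {w z : List α} {v : ℕ → α}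
    (hz : PrefixSeq z v) (h : w <:+: z) : FactorOf w v := by
  obtain ⟨s, t, rfl⟩ := h
  refine ⟨s.length, fun i hi => ?_⟩
  have h1 := hz (s.length + i) (by simp only [List.length_append]; omega)
  rw [Nat.zero_add, List.append_assoc, List.getElem?_append_right (by omega),
    List.getElem?_append_left (by omega), Nat.add_sub_cancel_left] at h1
  exact h1

theorem PrefixSeq.map {α β : Type*} {z : List α} {v : ℕ → α} (hz : PrefixSeq z v) (g : α → β) :
    PrefixSeq (z.map g) (fun n => g (v n)) := by
  intro i hi
  rw [List.length_map] at hi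
  rw [List.getElem?_map, hz i hi, Option.map_some]

theorem PrefixSeq.isPrefix {α : Type*} {w z : List α} {v : ℕ → α}
    (hw : PrefixSeq w v) (hz : PrefixSeq z v) (h : w.length ≤ z.length) : w <+: z := by
  rw [List.prefix_iff_getElem?]
  intro i hi
  rw [hz i (by omega), ← hw i hi, List.getElem?_eq_getElem hi]

theorem FactorOf.mono {α : Type*} {w z : List α} {v : ℕ → α}
    (hz : FactorOf z v) (h : w <:+ z) : FactorOf w v := by
  obtain ⟨s, rfl⟩ := h
  obtain ⟨j, hj⟩ := hz
  refine ⟨j + s.length, fun i hi => ?_⟩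
  have h1 := hj (s.length + i) (by simp only [List.length_append]; omega)
  rw [List.getElem?_append_right (by omega), Nat.add_sub_cancel_left, ← Nat.add_assoc] at h1
  exact h1

theorem twin_twin (a : Letter) : twin (twin a) = a := by
  simp [twin]

theorem map_twin_twin (w : List Letter) : (w.map twin).map twin = w := by
  simp [twin_twin, Function.comp_def]

theorem proj_twin (a : Letter) : proj (twin a) = !proj a := by
  unfold proj twin
  split <;> rfl

theorem xiL_twin (k : ℕ) (a : Letter) : xiL k (twin a) = (xiL k a).map twin := by
  unfold xiL twin
  split_ifs <;> simp

theorem xiW_append (k : ℕ) (v w : List Letter) : xiW k (v ++ w) = xiW k v ++ xiW k w :=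
  List.flatMap_append

theorem xiW_map_twin (k : ℕ) (w : List Letter) : xiW k (w.map twin) = (xiW k w).map twin := by
  simp only [xiW, List.flatMap_map, List.map_flatMap, xiL_twin]

theorem iterate_xiW_append (k n : ℕ) (v w : List Letter) :
    (xiW k)^[n] (v ++ w) = (xiW k)^[n] v ++ (xiW k)^[n] w := by
  induction n generalizing v w with
  | zero => rfl
  | succ n ih => simp only [Function.iterate_succ_apply, xiW_append, ih]

theorem iterate_xiW_map_twin (k n : ℕ) (w : List Letter) :
    (xiW k)^[n] (w.map twin) = ((xiW k)^[n] w).map twin := by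
  induction n generalizing w with
  | zero => rfl
  | succ n ih => simp only [Function.iterate_succ_apply, xiW_map_twin, ih]

theorem xiPow_succ (k n : ℕ) : xiPow k (n + 1) = xiPow k n ++ (xiW k)^[n] [(false, 1)] := by
  rw [xiPow, Function.iterate_succ_apply, xiPow, ← iterate_xiW_append]
  simp [xiW, xiL]

theorem iterate_xiW_one {k n : ℕ} (h : n + 1 < k) : (xiW k)^[n] [(false, 1)] = [(false, n + 1)] := by
  induction n with
  | zero => rfl
  | succ n ih =>
    rw [Function.iterate_succ_apply', ih (by omega)]
    have h1 : n + 1 ≠ k - 1 := by omega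
    simp [xiW, xiL, h1]

theorem iterate_xiW_one_last {k : ℕ} (hk : 2 ≤ k) :
    (xiW k)^[k - 1] [(false, 1)] = [(true, 0)] := by
  obtain ⟨k, rfl⟩ := Nat.exists_eq_add_of_le' hk
  rw [show k + 2 - 1 = k + 1 from rfl, Function.iterate_succ_apply', iterate_xiW_one (by omega)]
  simp [xiW, xiL]

theorem xiPow_add {k : ℕ} (hk : 2 ≤ k) (n : ℕ) :
    xiPow k (n + k) = xiPow k (n + k - 1) ++ (xiPow k n).map twin := by
  have h : n + k = n + (k - 1) + 1 := by omega
  have h' : n + k - 1 = n + (k - 1) := by omega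
  rw [h', h, xiPow_succ, Function.iterate_add_apply, iterate_xiW_one_last hk, xiPow, xiPow,
    ← iterate_xiW_map_twin]
  rfl

theorem lt_length_xiPow {k : ℕ} (hk : 2 ≤ k) (n : ℕ) : n < (xiPow k n).length := by
  induction n using Nat.strong_induction_on with
  | _ n ih =>
    rcases n with _ | n
    · simp [xiPow]
    have h0 := ih n (by omega)
    rcases lt_or_ge (n + 1) k with h | h
    · rw [xiPow_succ, iterate_xiW_one h]
      simp only [List.length_append, List.length_singleton]
      omega
    · obtain ⟨m, hm⟩ := Nat.exists_eq_add_of_le' h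
      have h1 := ih m (by omega)
      rw [hm, xiPow_add hk, ← hm]
      simp only [List.length_append, List.length_map, Nat.add_sub_cancel]
      omega

theorem map_proj_xiPow {k m : ℕ} (hk : 2 ≤ k) (hm : m ≤ k) :
    (xiPow k m).map proj = false :: List.replicate m true := by
  induction m with
  | zero => simp [xiPow, proj]
  | succ m ih =>
    rw [xiPow_succ, List.map_append, ih (by omega), List.replicate_succ', List.cons_append]
    rcases lt_or_ge (m + 1) k with h | h
    · rw [iterate_xiW_one h]
      simp [proj]
    · obtain rfl : m = k - 1 := by omega
      rw [iterate_xiW_one_last hk]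
      simp [proj]

theorem map_proj_map_twin_xiPow {k m : ℕ} (hk : 2 ≤ k) (hm : m ≤ k) :
    ((xiPow k m).map twin).map proj = true :: List.replicate m false := by
  have h : ((xiPow k m).map twin).map proj = ((xiPow k m).map proj).map (fun b => !b) := by
    simp [proj_twin]
  rw [h, map_proj_xiPow hk hm]
  simp

theorem map_twin_xiPow_suffix {k : ℕ} (hk : 2 ≤ k) (n : ℕ) :
    (xiPow k n).map twin <:+ xiPow k (n + k) :=
  ⟨_, (xiPow_add hk n).symm⟩

theorem xiPow_suffix {k : ℕ} (hk : 2 ≤ k) (n q : ℕ) :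
    xiPow k n <:+ xiPow k (n + 2 * k * q) := by
  induction q with
  | zero => exact List.suffix_rfl
  | succ q ih =>
    have h := (map_twin_xiPow_suffix hk (n + 2 * k * q)).map twin
    rw [map_twin_twin] at h
    have h' := map_twin_xiPow_suffix hk (n + 2 * k * q + k)
    rw [show n + 2 * k * (q + 1) = n + 2 * k * q + k + k by ring]
    exact ih.trans (h.trans h')

theorem xiPow_append_self_infix {k : ℕ} (hk : 2 ≤ k) (n : ℕ) :
    xiPow k n ++ xiPow k n <:+: xiPow k (n + 1 + k + k) := by
  have h : xiPow k n ++ xiPow k n <:+: (xiPow k (n + 1 + k)).map twin := by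
    rw [xiPow_add hk, show n + 1 + k - 1 = n + k by omega, xiPow_add hk n, xiPow_succ]
    simp only [List.map_append, map_twin_twin]
    exact ⟨(xiPow k (n + k - 1)).map twin, (xiW k)^[n] [(false, 1)], by
      simp only [List.append_assoc]⟩
  exact h.trans (map_twin_xiPow_suffix hk _).isInfix

theorem factorOf_append_of_suffix {k : ℕ} (hk : 2 ≤ k) {u : ℕ → Letter} (hu : IsFixedPoint k u)
    {f : List Letter} (hpre : PrefixSeq f u) {s : List Letter} {n : ℕ} (hs : s <:+ xiPow k n) :
    FactorOf ((s ++ f).map proj) (fun n => proj (u n)) := by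
  have hn : f.length ≤ n + 2 * k * f.length := by nlinarith
  set N := n + 2 * k * f.length with hN
  obtain ⟨p, hp⟩ := hs.trans (xiPow_suffix hk n f.length)
  obtain ⟨r, hr⟩ := hpre.isPrefix (hu N) (hn.trans (lt_length_xiPow hk N).le)
  have h : s ++ f <:+: xiPow k N ++ xiPow k N := ⟨p, r, by
    rw [← List.append_assoc, hp, List.append_assoc, hr]⟩
  exact ((hu _).map proj).factorOf ((h.trans (xiPow_append_self_infix hk N)).map proj)

/-- for `k ≥ 4`, if `f` is a left special factor of `u_k` whose first
letter is `0` and `f` is a prefix of `u_k`, then for every `1 ≤ i ≤ k`, both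
`0^{i−1}π(f)` and `1^{i−1}π(f)` are left special factors of `x_k = π(u_k)`. -/
theorem stmt_17 (k : ℕ) (hk : 4 ≤ k) (u : ℕ → Letter) (hu : IsFixedPoint k u)
    (x : ℕ → Bool) (hx : x = fun n => proj (u n))
    (f : List Letter) (hf : LeftSpecial f u)
    (hhead : f.head? = some ((false : Bool), (0 : ℕ)))
    (hpre : PrefixSeq f u) :
    ∀ i : ℕ, 1 ≤ i → i ≤ k →
      LeftSpecial (List.replicate (i - 1) false ++ f.map proj) x ∧
      LeftSpecial (List.replicate (i - 1) true ++ f.map proj) x := by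
  have hk2 : 2 ≤ k := by omega
  have hA : ∀ m ≤ k, FactorOf (false :: (List.replicate m true ++ f.map proj)) x := by
    intro m hm
    have h := factorOf_append_of_suffix hk2 hu hpre (List.suffix_refl (xiPow k m))
    rwa [List.map_append, map_proj_xiPow hk2 hm, ← hx] at h
  have hB : ∀ m ≤ k, FactorOf (true :: (List.replicate m false ++ f.map proj)) x := by
    intro m hm
    have h := factorOf_append_of_suffix hk2 hu hpre (map_twin_xiPow_suffix hk2 m)
    rwa [List.map_append, map_proj_map_twin_xiPow hk2 hm, ← hx] at h
  intro i hi hik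
  obtain ⟨m, rfl⟩ := Nat.exists_eq_add_of_le' hi
  exact ⟨⟨true, false, by decide, hB m (by omega), (hB (m + 1) hik).mono (List.suffix_cons _ _)⟩,
    ⟨false, true, by decide, hA m (by omega), (hA (m + 1) hik).mono (List.suffix_cons _ _)⟩⟩
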